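/- Let M ≥ 1 and let W_M = {e^{j2πk/M} : k = 0, 1, …, M−1} be the set of M-th roots of unity. Then (1/(2π)) ∫_0^{2π} max_{w ∈ W_M} ⟨e^{jθ}, w⟩ dθ = (M/π) · sin(π/M). -/

import Mathlib

open Complex MeasureTheory

/-- The set of `M`-th roots of unity `{e^{j2πk/M} : k = 0, …, M−1}`. -/
noncomputable def WM (M : ℕ) : Set ℂ :=
  (fun k : ℕ => Complex.exp ((2 * Real.pi * k / M : ℝ) * Complex.I)) '' Set.Iio M

/-- The support function of a set `W ⊆ ℂ` evaluated at the direction `e^{jθ}`: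
`sup_{w ∈ W} ⟨e^{jθ}, w⟩ = sup_{w ∈ W} Re(e^{-jθ} w)`. -/
noncomputable def suppFn (W : Set ℂ) (θ : ℝ) : ℝ :=
  sSup ((fun w => (Complex.exp (-(θ : ℂ) * Complex.I) * w).re) '' W)

theorem re_exp_neg_mul_exp (θ x : ℝ) :
    (Complex.exp (-(θ : ℂ) * Complex.I) * Complex.exp (x * Complex.I)).re =
      Real.cos (x - θ) := by
  rw [← Complex.exp_add, ← Complex.exp_ofReal_mul_I_re]
  congr 2
  push_cast
  ring

theorem image_re_exp_mul_WM (M : ℕ) (hM : 1 ≤ M) (θ : ℝ) :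
    (fun w => (Complex.exp (-(θ : ℂ) * Complex.I) * w).re) '' WM M =
      Set.range fun k : ℤ => Real.cos (2 * Real.pi * k / M - θ) := by
  have hM0 : (M : ℝ) ≠ 0 := by positivity
  ext y
  simp only [WM, Set.image_image, re_exp_neg_mul_exp, Set.mem_image, Set.mem_Iio, Set.mem_range]
  constructor
  · rintro ⟨k, -, rfl⟩
    exact ⟨k, by simp⟩
  · rintro ⟨k, rfl⟩
    have hMZ : (0 : ℤ) < M := by exact_mod_cast hM
    refine ⟨(k % M).toNat, ?_, ?_⟩
    · have := Int.emod_lt_of_pos k hMZ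
      have := Int.emod_nonneg k hMZ.ne'
      omega
    · have hcast : (((k % M).toNat : ℕ) : ℝ) = ((k % M : ℤ) : ℝ) := by
        exact_mod_cast congrArg (Int.cast (R := ℝ))
          (Int.toNat_of_nonneg (Int.emod_nonneg k hMZ.ne'))
      have hk : (k : ℝ) = ((k % M : ℤ) : ℝ) + M * ((k / M : ℤ) : ℝ) := by
        exact_mod_cast (Int.emod_add_mul_ediv k M).symm
      rw [hcast, ← Real.cos_add_int_mul_two_pi _ (k / M)]
      congr 1
      rw [hk]
      field_simp
      ring

theorem suppFn_WM_periodic (M : ℕ) (hM : 1 ≤ M) :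
    Function.Periodic (suppFn (WM M)) (2 * Real.pi / M) := by
  intro θ
  have hM0 : (M : ℝ) ≠ 0 := by positivity
  unfold suppFn
  rw [image_re_exp_mul_WM M hM, image_re_exp_mul_WM M hM,
    ← (Equiv.addRight (1 : ℤ)).surjective.range_comp]
  congr 2
  funext k
  simp only [Function.comp_apply, Equiv.coe_addRight]
  congr 1
  push_cast
  field_simp
  ring

theorem suppFn_WM_eq_cos (M : ℕ) (hM : 1 ≤ M) {θ : ℝ}
    (hθ : θ ∈ Set.Icc (-(Real.pi / M)) (Real.pi / M)) :
    suppFn (WM M) θ = Real.cos θ := by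
  have hM0 : (0 : ℝ) < M := by positivity
  refine IsGreatest.csSup_eq ⟨?_, ?_⟩
  · rw [image_re_exp_mul_WM M hM]
    exact ⟨0, by simp⟩
  · rintro _ ⟨_, ⟨k, hk, rfl⟩, rfl⟩
    simp only [re_exp_neg_mul_exp]
    rw [← sub_nonneg, Real.cos_sub_cos,
      show (θ + (2 * Real.pi * k / M - θ)) / 2 = Real.pi / M * k by ring,
      show (θ - (2 * Real.pi * k / M - θ)) / 2 = -(Real.pi / M * k - θ) by ring, Real.sin_neg]
    rcases Nat.eq_zero_or_pos k with rfl | hk0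
    · simp
    have hk1 : (1 : ℝ) ≤ k := by exact_mod_cast hk0
    have hkM : (k : ℝ) + 1 ≤ M := by exact_mod_cast hk
    have hpos : 0 < Real.pi / M := by positivity
    have hpi : Real.pi / M * M = Real.pi := by field_simp
    have hlow : Real.pi / M * 1 ≤ Real.pi / M * k := by gcongr
    have hupp : Real.pi / M * (k + 1) ≤ Real.pi / M * M := by gcongr
    have hsin₁ : 0 ≤ Real.sin (Real.pi / M * k) :=
      Real.sin_nonneg_of_nonneg_of_le_pi (by linarith) (by linarith)
    have hsin₂ : 0 ≤ Real.sin (Real.pi / M * k - θ) :=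
      Real.sin_nonneg_of_nonneg_of_le_pi (by linarith [hθ.2]) (by linarith [hθ.1])
    nlinarith [mul_nonneg hsin₁ hsin₂]

theorem stmt9 (M : ℕ) (hM : 1 ≤ M) :
    (1 / (2 * Real.pi)) * (∫ θ in (0 : ℝ)..(2 * Real.pi), suppFn (WM M) θ) =
      (M / Real.pi) * Real.sin (Real.pi / M) := by
  have hM0 : (0 : ℝ) < M := by positivity
  have hpos : 0 < Real.pi / M := by positivity
  have hper := suppFn_WM_periodic M hM
  have hEq : Set.EqOn (suppFn (WM M)) Real.cos
      (Set.uIcc (-(Real.pi / M)) (Real.pi / M)) := by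
    rw [Set.uIcc_of_le (by linarith)]
    exact fun θ hθ => suppFn_WM_eq_cos M hM hθ
  have hend : -(Real.pi / M) + 2 * Real.pi / M = Real.pi / M := by ring
  have hbase : ∫ θ in (0 : ℝ)..(0 + 2 * Real.pi / M), suppFn (WM M) θ =
      2 * Real.sin (Real.pi / M) := by
    rw [hper.intervalIntegral_add_eq 0 (-(Real.pi / M)), hend,
      intervalIntegral.integral_congr hEq, integral_cos, Real.sin_neg]
    ring
  have hloc : IntervalIntegrable (suppFn (WM M)) volume
      (-(Real.pi / M)) (-(Real.pi / M) + 2 * Real.pi / M) := by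
    rw [hend]
    exact (Real.continuous_cos.continuousOn.congr hEq).intervalIntegrable
  have hint := hper.intervalIntegral_add_zsmul_eq M 0
    (hper.intervalIntegrable (by positivity) hloc)
  have htop : (0 : ℝ) + (M : ℤ) • (2 * Real.pi / M) = 2 * Real.pi := by
    simp
    field_simp
  rw [htop, hbase] at hint
  rw [hint]
  simp
  field_simp
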